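/- Let F on U and G on V be n-linear forms (n ≥ 2) over a field K that are symmetrically equivalent via the linear bijections φ₁,…,φₙ : U → V, and suppose φ₁ = ⋯ = φ_t = φ for some t < n. Then the linear mapping τ := φ ∘ φ_{t+1}⁻¹ : V → V is G-selfadjoint. -/

import Mathlib

section Defs

variable {K : Type*} [Field K] {n : ℕ}

/-- The restriction of a multilinear form to a submodule. -/
def formRestrict {U : Type*} [AddCommGroup U] [Module K U]
    (F : MultilinearMap K (fun _ : Fin n => U) K) (W : Submodule K U) :
    MultilinearMap K (fun _ : Fin n => W) K :=
  F.compLinearMap fun _ => W.subtype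

/-- Two multilinear forms are congruent if a single linear bijection carries one to the other. -/
def FormCongruent {U V : Type*} [AddCommGroup U] [Module K U] [AddCommGroup V] [Module K V]
    (F : MultilinearMap K (fun _ : Fin n => U) K)
    (G : MultilinearMap K (fun _ : Fin n => V) K) : Prop :=
  ∃ φ : U ≃ₗ[K] V, ∀ u : Fin n → U, F u = G fun i => φ (u i)

/-- Symmetric equivalence of multilinear forms. -/
def FormSymmEquiv {U V : Type*} [AddCommGroup U] [Module K U] [AddCommGroup V] [Module K V]
    (F : MultilinearMap K (fun _ : Fin n => U) K)
    (G : MultilinearMap K (fun _ : Fin n => V) K) : Prop :=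
  ∃ φ : Fin n → U ≃ₗ[K] V, ∀ (σ : Equiv.Perm (Fin n)) (u : Fin n → U),
    F u = G fun i => φ (σ i) (u i)

/-- `W` is a direct-sum decomposition of the underlying space for which `F` vanishes on
mixed tuples, i.e. `F = ⨁ᵢ F|Wᵢ`. -/
def IsDecompFamily {U : Type*} [AddCommGroup U] [Module K U] {ι : Type*} [DecidableEq ι]
    (F : MultilinearMap K (fun _ : Fin n => U) K) (W : ι → Submodule K U) : Prop :=
  DirectSum.IsInternal W ∧
    ∀ (x : Fin n → U) (k l : Fin n) (i j : ι), i ≠ j → x k ∈ W i → x l ∈ W j → F x = 0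

/-- A multilinear form is indecomposable if in every direct-sum decomposition one of the
two subspaces is zero. -/
def FormIndecomposable {U : Type*} [AddCommGroup U] [Module K U]
    (F : MultilinearMap K (fun _ : Fin n => U) K) : Prop :=
  ∀ W₁ W₂ : Submodule K U, IsCompl W₁ W₂ →
    (∀ (x : Fin n → U) (k l : Fin n), x k ∈ W₁ → x l ∈ W₂ → F x = 0) →
    W₁ = ⊥ ∨ W₂ = ⊥

/-- A multilinear form has no zero direct summands if in every direct-sum decomposition the
summand that is the zero form corresponds to the zero subspace. -/
def FormNoZeroSummand {U : Type*} [AddCommGroup U] [Module K U]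
    (F : MultilinearMap K (fun _ : Fin n => U) K) : Prop :=
  ∀ W₁ W₂ : Submodule K U, IsCompl W₁ W₂ →
    (∀ (x : Fin n → U) (k l : Fin n), x k ∈ W₁ → x l ∈ W₂ → F x = 0) →
    (∀ x : Fin n → U, (∀ k, x k ∈ W₂) → F x = 0) → W₂ = ⊥

/-- A linear map `τ` is `G`-selfadjoint if applying `τ` in any one argument of `G`
gives the same value regardless of the argument chosen. -/
def FormSelfAdjoint {V : Type*} [AddCommGroup V] [Module K V]
    (G : MultilinearMap K (fun _ : Fin n => V) K) (τ : V →ₗ[K] V) : Prop :=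
  ∀ (v : Fin n → V) (i j : Fin n),
    G (Function.update v i (τ (v i))) = G (Function.update v j (τ (v j)))

end Defs

/-- A permutation can be chosen to take any two distinct points to any two distinct points. -/
theorem exists_perm_apply_eq_pair {α : Type*} [DecidableEq α] {i j a b : α}
    (hij : i ≠ j) (hab : a ≠ b) : ∃ σ : Equiv.Perm α, σ i = a ∧ σ j = b := by
  refine ⟨Equiv.swap (Equiv.swap i a j) b * Equiv.swap i a, ?_, ?_⟩
  · rw [Equiv.Perm.mul_apply, Equiv.swap_apply_left]
    refine Equiv.swap_apply_of_ne_of_ne (fun h => hij ?_) hab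
    rw [← Equiv.swap_apply_left i a] at h
    exact (Equiv.swap i a).injective (by simpa using h)
  · rw [Equiv.Perm.mul_apply, Equiv.swap_apply_left]

/-- In a symmetric equivalence, `φ a ∘ (φ b)⁻¹` is selfadjoint for any two indices `a`, `b`. -/
theorem formSelfAdjoint_comp_symm {K : Type*} [Field K] {n : ℕ}
    {U V : Type*} [AddCommGroup U] [Module K U] [AddCommGroup V] [Module K V]
    (F : MultilinearMap K (fun _ : Fin n => U) K)
    (G : MultilinearMap K (fun _ : Fin n => V) K)
    (φ : Fin n → U ≃ₗ[K] V)
    (hsym : ∀ (σ : Equiv.Perm (Fin n)) (u : Fin n → U),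
      F u = G fun i => φ (σ i) (u i))
    (a b : Fin n) :
    FormSelfAdjoint G ((φ a).toLinearMap ∘ₗ (φ b).symm.toLinearMap) := by
  intro v i j
  rcases eq_or_ne a b with rfl | hab
  · simp
  rcases eq_or_ne i j with rfl | hij
  · rfl
  obtain ⟨σ, hi, hj⟩ := exists_perm_apply_eq_pair hij hab
  let u : Fin n → U := fun k =>
    if k = i then (φ b).symm (v k) else (φ (σ k)).symm (v k)
  have h₁ : (fun k => φ (σ k) (u k)) =
      Function.update v i (((φ a).toLinearMap ∘ₗ (φ b).symm.toLinearMap) (v i)) := by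
    ext k
    by_cases hk : k = i
    · subst hk
      simp [u, hi]
    · simp [u, hk]
  have h₂ : (fun k => φ ((σ * Equiv.swap i j) k) (u k)) =
      Function.update v j (((φ a).toLinearMap ∘ₗ (φ b).symm.toLinearMap) (v j)) := by
    ext k
    by_cases hki : k = i
    · subst hki
      simp [u, hj, hij]
    · by_cases hkj : k = j
      · subst hkj
        simp [u, hi, hj, hki]
      · simp [u, hki, hkj, Equiv.swap_apply_of_ne_of_ne]
  rw [← h₁, ← h₂, ← hsym, ← hsym]

/-- If `F` and `G` are symmetrically equivalent via `φ₁, …, φₙ` (indexed here by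
`Fin n`, zero-based) with `φ₁ = ⋯ = φ_t = φ` for some `t < n`, then
`τ := φ ∘ φ_{t+1}⁻¹ : V → V` is `G`-selfadjoint. -/
theorem stmt_7 {K : Type*} [Field K] {n : ℕ} (hn : 2 ≤ n)
    {U V : Type*} [AddCommGroup U] [Module K U] [FiniteDimensional K U]
    [AddCommGroup V] [Module K V] [FiniteDimensional K V]
    (F : MultilinearMap K (fun _ : Fin n => U) K)
    (G : MultilinearMap K (fun _ : Fin n => V) K)
    (φ : Fin n → U ≃ₗ[K] V)
    (hsym : ∀ (σ : Equiv.Perm (Fin n)) (u : Fin n → U),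
      F u = G fun i => φ (σ i) (u i))
    (t : ℕ) (h0 : 0 < t) (ht : t < n)
    (hconst : ∀ i : Fin n, (i : ℕ) < t → φ i = φ ⟨0, h0.trans ht⟩) :
    FormSelfAdjoint G
      ((φ ⟨0, h0.trans ht⟩).toLinearMap ∘ₗ (φ ⟨t, ht⟩).symm.toLinearMap) := by
  exact formSelfAdjoint_comp_symm F G φ hsym _ _
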